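/- (Far-field energy limit) Let ψ : ℝ² → ℂ be measurable and let ψ^∞ : ℝ → ℂ be continuous and 2π-periodic. Suppose there exist constants C > 0 and ρ₀ > 0 such that | ρ^{1/2} ψ(ρ cos θ, ρ sin θ) − e^{i κ₀(ρ cos θ, ρ sin θ) ρ} ψ^∞(θ) | ≤ C ρ^{−1} for all ρ ≥ ρ₀ and all θ ∈ [0, 2π]. Then lim_{ρ→∞} ∫_{∂B_ρ} κ₀(ξ) |ψ(ξ)|² ds(ξ) = ∫₀^{2π} κ₀(cos θ, sin θ) |ψ^∞(θ)|² dθ. -/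

import Mathlib

noncomputable section
open MeasureTheory Real Filter Topology

/-- Points of the plane ℝ². -/
abbrev Pt : Type := EuclideanSpace ℝ (Fin 2)

/-- The point with coordinates (a, b). -/
def pt (a b : ℝ) : Pt := (WithLp.equiv 2 (Fin 2 → ℝ)).symm ![a, b]

/-- The point ρ·(cos θ, sin θ) on the circle of radius ρ. -/
def ptc (ρ θ : ℝ) : Pt := pt (ρ * Real.cos θ) (ρ * Real.sin θ)

/-- The Laplacian of a complex-valued function on ℝ². -/
def lap (u : Pt → ℂ) (x : Pt) : ℂ :=
  fderiv ℝ (fun y => fderiv ℝ u y (pt 1 0)) x (pt 1 0) +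
  fderiv ℝ (fun y => fderiv ℝ u y (pt 0 1)) x (pt 0 1)

/-- Radial (outward normal) derivative on a circle centered at the origin: ∇F(ξ)·(ξ/|ξ|). -/
def dnu (F : Pt → ℂ) (ξ : Pt) : ℂ := fderiv ℝ F ξ ((‖ξ‖⁻¹ : ℝ) • ξ)

/-- Integral over the circle ∂B_ρ: ∫₀^{2π} F(ρ cos θ, ρ sin θ) ρ dθ (complex valued). -/
def circInt (ρ : ℝ) (F : Pt → ℂ) : ℂ := ∫ θ in (0:ℝ)..(2 * π), F (ptc ρ θ) * (ρ : ℂ)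

/-- Integral over the circle ∂B_ρ: ∫₀^{2π} F(ρ cos θ, ρ sin θ) ρ dθ (real valued). -/
def circIntR (ρ : ℝ) (F : Pt → ℝ) : ℝ := ∫ θ in (0:ℝ)..(2 * π), F (ptc ρ θ) * ρ

/-- The background two-layer wavenumber κ₀ : equal to κ₁ on {x₂ > 0} and κ₂ on {x₂ ≤ 0}. -/
def kappa0 (κ1 κ2 : ℝ) (x : Pt) : ℝ := if 0 < x 1 then κ1 else κ2

theorem kappa0_ptc_of_pos (κ1 κ2 : ℝ) {ρ : ℝ} (hρ : 0 < ρ) (θ : ℝ) :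
    kappa0 κ1 κ2 (ptc ρ θ) = kappa0 κ1 κ2 (ptc 1 θ) := by
  simp [kappa0, ptc, pt, hρ]

theorem measurable_kappa0 (κ1 κ2 : ℝ) : Measurable (kappa0 κ1 κ2) :=
  Measurable.ite (measurableSet_lt measurable_const (by fun_prop))
    measurable_const measurable_const

theorem continuous_ptc (ρ : ℝ) : Continuous (ptc ρ) := by
  refine (PiLp.continuous_toLp 2 _).comp (continuous_pi fun i => ?_)
  fin_cases i
  · exact continuous_const.mul Real.continuous_cos
  · exact continuous_const.mul Real.continuous_sin

theorem abs_kappa0_le {κ1 κ2 : ℝ} (hκ1 : 0 < κ1) (hκ2 : 0 < κ2) (x : Pt) :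
    |kappa0 κ1 κ2 x| ≤ κ1 + κ2 := by
  unfold kappa0
  split_ifs
  · rw [abs_of_pos hκ1]; linarith
  · rw [abs_of_pos hκ2]; linarith

theorem norm_exp_I_mul_ofReal_mul_ofReal (k ρ : ℝ) :
    ‖Complex.exp (Complex.I * (k : ℂ) * (ρ : ℂ))‖ = 1 := by
  rw [mul_assoc, mul_comm, ← Complex.ofReal_mul, Complex.norm_exp_ofReal_mul_I]

theorem norm_sq_rpow_half_mul {ρ : ℝ} (hρ : 0 ≤ ρ) (z : ℂ) :
    ‖((ρ ^ ((1:ℝ)/2) : ℝ) : ℂ) * z‖ ^ 2 = ‖z‖ ^ 2 * ρ := by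
  rw [norm_mul, Complex.norm_real, Real.norm_eq_abs, mul_pow, sq_abs, ← Real.sqrt_eq_rpow,
    Real.sq_sqrt hρ, mul_comm]

/-- far-field energy limit: if ρ^{1/2}ψ(ρe_θ) ≈ e^{iκ₀ρ}ψ^∞(θ) with error O(ρ⁻¹),
then ∫_{∂B_ρ} κ₀ |ψ|² ds → ∫₀^{2π} κ₀(cos θ, sin θ) |ψ^∞(θ)|² dθ as ρ → ∞. -/
theorem far_field_energy_limit
    (κ1 κ2 : ℝ) (hκ1 : 0 < κ1) (hκ2 : 0 < κ2)
    (ψ : Pt → ℂ) (hψ : Measurable ψ)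
    (ψinf : ℝ → ℂ) (hψinf : Continuous ψinf) (hper : ∀ θ, ψinf (θ + 2 * π) = ψinf θ)
    (C ρ₀ : ℝ) (hC : 0 < C) (hρ₀ : 0 < ρ₀)
    (hb : ∀ ρ ≥ ρ₀, ∀ θ ∈ Set.Icc (0:ℝ) (2 * π),
      ‖((ρ ^ ((1:ℝ)/2) : ℝ) : ℂ) * ψ (ptc ρ θ)
          - Complex.exp (Complex.I * ((kappa0 κ1 κ2 (ptc ρ θ) : ℝ) : ℂ) * (ρ : ℂ)) * ψinf θ‖
        ≤ C / ρ) :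
    Tendsto (fun ρ => circIntR ρ (fun ξ => kappa0 κ1 κ2 ξ * ‖ψ ξ‖ ^ 2)) atTop
      (𝓝 (∫ θ in (0:ℝ)..(2 * π), kappa0 κ1 κ2 (ptc 1 θ) * ‖ψinf θ‖ ^ 2)) := by
  have hab : ∀ ρ ≥ ρ₀, ∀ θ ∈ Set.Icc (0:ℝ) (2 * π),
      |‖((ρ ^ ((1:ℝ)/2) : ℝ) : ℂ) * ψ (ptc ρ θ)‖ - ‖ψinf θ‖| ≤ C / ρ := by
    intro ρ hρ θ hθ
    have h := (abs_norm_sub_norm_le _ _).trans (hb ρ hρ θ hθ)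
    rwa [norm_mul (Complex.exp _), norm_exp_I_mul_ofReal_mul_ofReal, one_mul] at h
  have hIoc : ∀ θ ∈ Set.uIoc (0:ℝ) (2 * π), θ ∈ Set.Icc (0:ℝ) (2 * π) := by
    intro θ hθ
    rw [Set.uIoc_of_le (by positivity)] at hθ
    exact Set.Ioc_subset_Icc_self hθ
  unfold circIntR
  refine intervalIntegral.tendsto_integral_filter_of_dominated_convergence
    (fun θ => (κ1 + κ2) * (‖ψinf θ‖ + C) ^ 2) ?_ ?_ ?_ ?_
  · refine Eventually.of_forall fun ρ => Measurable.aestronglyMeasurable ?_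
    have hp := (continuous_ptc ρ).measurable
    exact (((measurable_kappa0 κ1 κ2).comp hp).mul
      ((hψ.comp hp).norm.pow_const 2)).mul_const ρ
  · filter_upwards [eventually_ge_atTop ρ₀, eventually_ge_atTop 1] with ρ hρ hρ1
    refine Eventually.of_forall fun θ hθ => ?_
    have h := (abs_le.1 (hab ρ hρ θ (hIoc θ hθ))).2
    have hCρ : C / ρ ≤ C := div_le_self hC.le hρ1
    rw [mul_assoc, ← norm_sq_rpow_half_mul (by linarith), norm_mul, Real.norm_eq_abs,
      Real.norm_of_nonneg (sq_nonneg _)]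
    gcongr
    · exact abs_kappa0_le hκ1 hκ2 _
    · linarith
  · exact Continuous.intervalIntegrable (by fun_prop) _ _
  · refine Eventually.of_forall fun θ hθ => ?_
    have hlim : Tendsto (fun ρ : ℝ => ‖((ρ ^ ((1:ℝ)/2) : ℝ) : ℂ) * ψ (ptc ρ θ)‖) atTop
        (𝓝 ‖ψinf θ‖) := by
      rw [tendsto_iff_dist_tendsto_zero]
      refine squeeze_zero' (Eventually.of_forall fun _ => dist_nonneg) ?_
        (tendsto_const_nhds.div_atTop tendsto_id : Tendsto (fun ρ : ℝ => C / ρ) atTop (𝓝 0))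
      filter_upwards [eventually_ge_atTop ρ₀] with ρ hρ
      exact hab ρ hρ θ (hIoc θ hθ)
    refine ((hlim.pow 2).const_mul (kappa0 κ1 κ2 (ptc 1 θ))).congr' ?_
    filter_upwards [eventually_gt_atTop 0] with ρ hρ
    rw [norm_sq_rpow_half_mul hρ.le, kappa0_ptc_of_pos κ1 κ2 hρ, mul_assoc]

end
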